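/- arXiv:2007.01101 — 2 statements merged into one kernel-verified Lean document; each statement's English description precedes it below -/
import Mathlib

section
/- Let p ≥ 1 with Hölder conjugate q (1/p + 1/q = 1, with 1/q = 0 when p = 1), let s, μ, ω > 0, and let f, g, h : ℝⁿ → [0,∞) be integrable functions with nonempty supports. Suppose that for all x ∈ supp f, y ∈ supp g, and λ ∈ [0,1], h((1-λ)^{1/q} μ^{1/p} x + λ^{1/q} ω^{1/p} y)^{1/s} ≥ (1-λ)^{1/q} μ^{1/p} f(x)^{1/s} + λ^{1/q} ω^{1/p} g(y)^{1/s}. Then (∫ h)^{p/(n+s)} ≥ μ (∫ f)^{p/(n+s)} + ω (∫ g)^{p/(n+s)}. -/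
open MeasureTheory Set Function

noncomputable section

abbrev En (n : ℕ) := EuclideanSpace ℝ (Fin n)

/-- the support of a nonnegative function: closure of `{x | f x ≠ 0}` -/
def fsupp {n : ℕ} (f : En n → ℝ) : Set (En n) := closure (Function.support f)

open scoped ENNReal NNReal Pointwise

theorem bm_aux {A B C : Set ℝ} (hA : IsCompact A) (hB : IsCompact B) (hA0 : A.Nonempty)
    (hB0 : B.Nonempty) (hC : ∀ a ∈ A, ∀ b ∈ B, a + b ∈ C) :
    volume A + volume B ≤ volume C := by
  obtain ⟨a, ha⟩ := hA.exists_isGreatest hA0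
  obtain ⟨b, hb⟩ := hB.exists_isLeast hB0
  have h1 : volume ((fun x => b + x) '' A) = volume A := by
    rw [image_add_left, measure_preimage_add]
  have h2 : volume ((fun x => a + x) '' B) = volume B := by
    rw [image_add_left, measure_preimage_add]
  have hm : MeasurableSet ((fun x => a + x) '' B) :=
    (hB.image (by fun_prop)).isClosed.measurableSet
  have hd : AEDisjoint volume ((fun x => b + x) '' A) ((fun x => a + x) '' B) := by
    refine measure_mono_null (t := {a + b}) ?_ (by simp)
    rintro z ⟨⟨x, hx, rfl⟩, ⟨y, hy, hxy⟩⟩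
    have := ha.2 hx
    have := hb.2 hy
    simp only [mem_singleton_iff] at *
    linarith
  rw [← h1, ← h2, ← measure_union₀ hm.nullMeasurableSet hd]
  refine measure_mono ?_
  rintro z (⟨x, hx, rfl⟩ | ⟨x, hx, rfl⟩)
  · simpa [add_comm] using hC x hx b hb.1
  · exact hC a ha.1 x hx

theorem bm_one {A B C : Set ℝ} (hA : MeasurableSet A) (hB : MeasurableSet B) (hA0 : A.Nonempty)
    (hB0 : B.Nonempty) (hC : ∀ a ∈ A, ∀ b ∈ B, a + b ∈ C) :
    volume A + volume B ≤ volume C := by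
  have key : ∀ K, IsCompact K → K ⊆ A → ∀ L, IsCompact L → L ⊆ B →
      volume K + volume L ≤ volume C := by
    intro K hK hKA L hL hLB
    obtain ⟨a, ha⟩ := hA0
    obtain ⟨b, hb⟩ := hB0
    have := bm_aux (C := C) (hK.insert a) (hL.insert b) (insert_nonempty _ _)
      (insert_nonempty _ _) (by
        intro x hx y hy
        exact hC x (insert_subset ha hKA hx) y (insert_subset hb hLB hy))
    refine le_trans ?_ this
    gcongr <;> exact subset_insert _ _
  rw [hA.measure_eq_iSup_isCompact, hB.measure_eq_iSup_isCompact]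
  simp only [iSup_and']
  refine ENNReal.biSup_add_biSup_le' ⟨∅, by simp⟩ ⟨∅, by simp⟩ ?_
  rintro K ⟨hK, hK'⟩ L ⟨hL, hL'⟩
  exact key K hK' hK L hL' hL

theorem pl1_norm {θ : ℝ} (h0 : 0 < θ) (h1 : θ < 1) {φ ψ η : ℝ → ℝ} (mφ : Measurable φ)
    (mψ : Measurable ψ) (mη : Measurable η) (pφ : ∀ x, 0 ≤ φ x) (pψ : ∀ x, 0 ≤ ψ x)
    (pη : ∀ x, 0 ≤ η x) (lφ : ∀ x, φ x ≤ 1) (lψ : ∀ x, ψ x ≤ 1)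
    (sφ : ∀ t < 1, ∃ x, t < φ x) (sψ : ∀ t < 1, ∃ x, t < ψ x)
    (H : ∀ x y, φ x ^ θ * ψ y ^ (1 - θ) ≤ η (θ * x + (1 - θ) * y)) :
    ENNReal.ofReal θ * (∫⁻ x, ENNReal.ofReal (φ x)) +
      ENNReal.ofReal (1 - θ) * (∫⁻ x, ENNReal.ofReal (ψ x)) ≤ ∫⁻ x, ENNReal.ofReal (η x) := by
  have h1' : 0 < 1 - θ := by linarith
  rw [lintegral_eq_lintegral_meas_lt _ (Filter.Eventually.of_forall pφ) mφ.aemeasurable,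
    lintegral_eq_lintegral_meas_lt _ (Filter.Eventually.of_forall pψ) mψ.aemeasurable,
    lintegral_eq_lintegral_meas_lt _ (Filter.Eventually.of_forall pη) mη.aemeasurable,
    ← lintegral_const_mul' _ _ ENNReal.ofReal_ne_top,
    ← lintegral_const_mul' _ _ ENNReal.ofReal_ne_top]
  refine (le_lintegral_add _ _).trans (setLIntegral_mono' measurableSet_Ioi fun t ht => ?_)
  have ht0 : 0 < t := ht
  by_cases ht1 : t < 1
  · have e1 : ENNReal.ofReal θ * volume {a | t < φ a} = volume (θ • {a | t < φ a}) := by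
      rw [Measure.addHaar_smul]; simp [abs_of_pos h0]
    have e2 : ENNReal.ofReal (1 - θ) * volume {a | t < ψ a} =
        volume ((1 - θ) • {a | t < ψ a}) := by
      rw [Measure.addHaar_smul]; simp [abs_of_pos h1']
    rw [e1, e2]
    refine bm_one ((measurableSet_lt measurable_const mφ).const_smul₀ θ)
      ((measurableSet_lt measurable_const mψ).const_smul₀ _)
      (Set.Nonempty.smul_set (sφ t ht1)) (Set.Nonempty.smul_set (sψ t ht1)) ?_
    rintro _ ⟨x, hx, rfl⟩ _ ⟨y, hy, rfl⟩
    simp only [mem_ofPred_eq, smul_eq_mul] at *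
    refine lt_of_lt_of_le ?_ (H x y)
    calc t = t ^ θ * t ^ (1 - θ) := by rw [← Real.rpow_add ht0]; simp
      _ < _ := by
        have a1 := Real.rpow_lt_rpow ht0.le hx h0
        have a2 := Real.rpow_lt_rpow ht0.le hy h1'
        have := Real.rpow_pos_of_pos ht0 θ
        have := Real.rpow_pos_of_pos ht0 (1-θ)
        exact mul_lt_mul'' a1 a2 (by positivity) (by positivity)
  · have e1 : {a | t < φ a} = ∅ := by
      ext x; simp; linarith [lφ x]
    have e2 : {a | t < ψ a} = ∅ := by
      ext x; simp; linarith [lψ x]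
    simp [e1, e2]

theorem ennreal_amgm {θ : ℝ} (h0 : 0 < θ) (h1 : θ < 1) (a b : ℝ≥0∞) :
    a ^ θ * b ^ (1 - θ) ≤ ENNReal.ofReal θ * a + ENNReal.ofReal (1 - θ) * b := by
  have h1' : 0 < 1 - θ := by linarith
  have hc : (θ⁻¹).HolderConjugate (1 - θ)⁻¹ := by
    rw [Real.holderConjugate_iff]
    exact ⟨by rw [one_lt_inv₀ h0]; exact h1, by simp⟩
  have := ENNReal.young_inequality (a ^ θ) (b ^ (1 - θ)) hc
  rw [← ENNReal.rpow_mul, ← ENNReal.rpow_mul, mul_inv_cancel₀ h0.ne', mul_inv_cancel₀ h1'.ne',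
    ENNReal.rpow_one, ENNReal.rpow_one, ENNReal.ofReal_inv_of_pos h0,
    ENNReal.ofReal_inv_of_pos h1', div_eq_mul_inv, div_eq_mul_inv, inv_inv, inv_inv] at this
  rwa [mul_comm _ a, mul_comm _ b]

theorem pl1_real {θ : ℝ} (h0 : 0 < θ) (h1 : θ < 1) {φ ψ η : ℝ → ℝ} (mφ : Measurable φ)
    (mψ : Measurable ψ) (mη : Measurable η) (pφ : ∀ x, 0 ≤ φ x) (pψ : ∀ x, 0 ≤ ψ x)
    (pη : ∀ x, 0 ≤ η x) (bφ : BddAbove (range φ)) (bψ : BddAbove (range ψ))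
    (nφ : ∃ x, φ x ≠ 0) (nψ : ∃ x, ψ x ≠ 0)
    (H : ∀ x y, φ x ^ θ * ψ y ^ (1 - θ) ≤ η (θ * x + (1 - θ) * y)) :
    (∫⁻ x, ENNReal.ofReal (φ x)) ^ θ * (∫⁻ x, ENNReal.ofReal (ψ x)) ^ (1 - θ)
      ≤ ∫⁻ x, ENNReal.ofReal (η x) := by
  have h1' : 0 < 1 - θ := by linarith
  have sup : ∀ φ : ℝ → ℝ, (∀ x, 0 ≤ φ x) → BddAbove (range φ) → (∃ x, φ x ≠ 0) →
      ∃ M : ℝ, 0 < M ∧ (∀ x, φ x / M ≤ 1) ∧ ∀ t < 1, ∃ x, t < φ x / M := by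
    rintro φ pφ bφ ⟨x, hx⟩
    have hM : 0 < ⨆ x, φ x := ((pφ x).lt_of_ne' hx).trans_le (le_ciSup bφ x)
    refine ⟨⨆ x, φ x, hM, fun x => ?_, fun t ht => ?_⟩
    · rw [div_le_one hM]; exact le_ciSup bφ x
    · obtain ⟨y, hy⟩ := exists_lt_of_lt_ciSup (show t * (⨆ x, φ x) < ⨆ x, φ x by nlinarith)
      exact ⟨y, by rwa [lt_div_iff₀ hM]⟩
  obtain ⟨M, hM, hM1, hM2⟩ := sup φ pφ bφ nφ
  obtain ⟨N, hN, hN1, hN2⟩ := sup ψ pψ bψ nψ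
  set K := M ^ θ * N ^ (1 - θ) with hK
  have hK0 : 0 < K := by positivity
  have main := pl1_norm h0 h1 (mφ.div_const M) (mψ.div_const N) (mη.div_const K)
    (fun x => div_nonneg (pφ x) hM.le) (fun x => div_nonneg (pψ x) hN.le)
    (fun x => div_nonneg (pη x) hK0.le) hM1 hN1 hM2 hN2 (by
      intro x y
      rw [Real.div_rpow (pφ x) hM.le, Real.div_rpow (pψ y) hN.le, div_mul_div_comm]
      gcongr
      exact H x y)
  have main2 := (ennreal_amgm h0 h1 _ _).trans main
  have sc : ∀ (f : ℝ → ℝ) (M : ℝ), 0 < M → ∫⁻ x, ENNReal.ofReal (f x) =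
      ENNReal.ofReal M * ∫⁻ x, ENNReal.ofReal (f x / M) := by
    intro f M hM
    rw [← lintegral_const_mul' _ _ ENNReal.ofReal_ne_top]
    congr 1; ext x
    rw [← ENNReal.ofReal_mul hM.le, mul_div_cancel₀ _ hM.ne']
  rw [sc φ M hM, sc ψ N hN, sc η K hK0, ENNReal.mul_rpow_of_nonneg _ _ h0.le,
    ENNReal.mul_rpow_of_nonneg _ _ h1'.le, mul_mul_mul_comm]
  refine mul_le_mul' (le_of_eq ?_) main2
  rw [ENNReal.ofReal_rpow_of_pos hM, ENNReal.ofReal_rpow_of_pos hN,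
    ← ENNReal.ofReal_mul (by positivity)]

/-- Prékopa–Leindler property of a measure. -/
def PLProp (V : Type) [AddCommGroup V] [Module ℝ V] [MeasureSpace V] : Prop :=
  ∀ θ : ℝ, 0 < θ → θ < 1 → ∀ f g h : V → ℝ≥0∞, Measurable f → Measurable g → Measurable h →
    (∀ x y, f x ^ θ * g y ^ (1 - θ) ≤ h (θ • x + (1 - θ) • y)) →
    (∫⁻ x, f x) ^ θ * (∫⁻ x, g x) ^ (1 - θ) ≤ ∫⁻ x, h x

theorem simple_bdd (φ : SimpleFunc ℝ ℝ≥0) : ∃ C : ℝ≥0, ∀ x, φ x ≤ C := by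
  obtain ⟨C, hC⟩ := φ.finite_range.bddAbove
  exact ⟨C, fun x => hC (mem_range_self x)⟩

theorem pl_one : PLProp ℝ := by
  intro θ h0 h1 f g h mf mg mh H
  have h1' : 0 < 1 - θ := by linarith
  have ex : ∀ (f : ℝ → ℝ≥0∞) (τ : ℝ), 0 < τ → ∀ a < (∫⁻ x, f x) ^ τ,
      ∃ φ : SimpleFunc ℝ ℝ≥0, (∀ x, (φ x : ℝ≥0∞) ≤ f x) ∧ a < (∫⁻ x, φ x) ^ τ := by
    intro f τ hτ a ha
    rw [← ENNReal.rpow_inv_lt_iff hτ, lintegral_eq_nnreal] at ha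
    simp only [lt_iSup_iff] at ha
    obtain ⟨φ, hφ, hlt⟩ := ha
    refine ⟨φ, hφ, ?_⟩
    rw [← ENNReal.rpow_inv_lt_iff hτ]
    rw [← SimpleFunc.lintegral_eq_lintegral] at hlt
    simpa using hlt
  refine ENNReal.mul_le_of_forall_lt fun a ha b hb => ?_
  obtain ⟨φ, hφ, ha'⟩ := ex f θ h0 a ha
  obtain ⟨ψ, hψ, hb'⟩ := ex g _ h1' b hb
  refine (mul_le_mul' ha'.le hb'.le).trans ?_
  have nz : ∀ (φ : SimpleFunc ℝ ℝ≥0) (τ : ℝ) (a : ℝ≥0∞), 0 < τ → a < (∫⁻ x, φ x) ^ τ →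
      ∃ x, (φ x : ℝ) ≠ 0 := by
    intro φ τ a hτ ha
    by_contra! hc
    have : ∀ x, φ x = 0 := fun x => by exact_mod_cast hc x
    simp [this, hτ] at ha
  obtain ⟨A, hA⟩ := simple_bdd φ
  obtain ⟨B, hB⟩ := simple_bdd ψ
  set K : ℝ≥0 := A ^ θ * B ^ (1 - θ) with hK
  have key := pl1_real h0 h1 (φ := fun x => φ x) (ψ := fun x => ψ x)
    (η := fun x => (min (h x) K).toReal) (φ.measurable.coe_nnreal_real)
    (ψ.measurable.coe_nnreal_real) ((mh.min measurable_const).ennreal_toReal) (by simp) (by simp)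
    (by simp) ⟨A, by rintro _ ⟨x, rfl⟩; exact_mod_cast hA x⟩
    ⟨B, by rintro _ ⟨x, rfl⟩; exact_mod_cast hB x⟩ (nz φ _ _ h0 ha') (nz ψ _ _ h1' hb') (by
      intro x y
      rw [← ENNReal.ofReal_le_iff_le_toReal (by simp), ENNReal.ofReal_mul (by positivity),
        ← NNReal.coe_rpow, ← NNReal.coe_rpow, ENNReal.ofReal_coe_nnreal,
        ENNReal.ofReal_coe_nnreal]
      refine le_min ?_ ?_
      · refine le_trans ?_ (H x y)
        rw [ENNReal.coe_rpow_of_nonneg _ h0.le, ENNReal.coe_rpow_of_nonneg _ h1'.le]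
        gcongr
        · exact hφ x
        · exact hψ y
      · rw [← ENNReal.coe_mul, ENNReal.coe_le_coe]
        exact mul_le_mul' (NNReal.rpow_le_rpow (hA x) h0.le) (NNReal.rpow_le_rpow (hB y) h1'.le))
  simp only [ENNReal.ofReal_coe_nnreal] at key
  refine key.trans (lintegral_mono fun x => ?_)
  rw [ENNReal.ofReal_toReal (by simp)]
  exact min_le_left _ _

theorem pl_pi (n : ℕ) : PLProp (Fin n → ℝ) := by
  induction n with
  | zero =>
    intro θ h0 h1 f g h mf mg mh H
    have e : ∀ f : (Fin 0 → ℝ) → ℝ≥0∞, ∫⁻ x, f x = f 0 := by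
      intro f
      rw [volume_pi, Measure.pi_of_empty _ (0 : Fin 0 → ℝ), lintegral_dirac]
    rw [e, e, e]
    simpa using H 0 0
  | succ n ih =>
    intro θ h0 h1 f g h mf mg mh H
    set E := MeasurableEquiv.piFinSuccAbove (fun _ : Fin (n + 1) => ℝ) 0 with hE
    have mp : MeasurePreserving E.symm :=
      (volume_preserving_piFinSuccAbove (fun _ : Fin (n + 1) => ℝ) 0).symm E
    have e : ∀ f : (Fin (n + 1) → ℝ) → ℝ≥0∞, Measurable f →
        ∫⁻ x, f x = ∫⁻ t, ∫⁻ x, f (E.symm (t, x)) := by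
      intro f mf
      rw [← mp.lintegral_comp mf]
      exact lintegral_prod _ (mf.comp E.symm.measurable).aemeasurable
    have m1 : ∀ f : (Fin (n + 1) → ℝ) → ℝ≥0∞, Measurable f →
        Measurable (fun t => ∫⁻ x, f (E.symm (t, x))) := by
      intro f mf
      exact Measurable.lintegral_prod_right' (mf.comp E.symm.measurable)
    rw [e f mf, e g mg, e h mh]
    refine pl_one θ h0 h1 _ _ _ (m1 f mf) (m1 g mg) (m1 h mh) fun t u => ?_
    refine ih θ h0 h1 _ _ _ ?_ ?_ ?_ fun x y => ?_
    · exact mf.comp (E.symm.measurable.comp measurable_prodMk_left)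
    · exact mg.comp (E.symm.measurable.comp measurable_prodMk_left)
    · exact mh.comp (E.symm.measurable.comp measurable_prodMk_left)
    · refine (H _ _).trans (le_of_eq ?_)
      congr 1
      ext i
      refine Fin.cases ?_ (fun j => ?_) i <;> simp [hE, MeasurableEquiv.piFinSuccAbove, Fin.insertNthEquiv]

theorem pl_euclid (n : ℕ) : PLProp (EuclideanSpace ℝ (Fin n)) := by
  intro θ h0 h1 f g h mf mg mh H
  have mp := PiLp.volume_preserving_toLp (Fin n)
  rw [← mp.lintegral_comp mf, ← mp.lintegral_comp mg, ← mp.lintegral_comp mh]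
  exact pl_pi n θ h0 h1 _ _ _ (mf.comp mp.measurable) (mg.comp mp.measurable)
    (mh.comp mp.measurable) fun x y => H _ _

theorem exists_meas_majorant {α : Type*} [MeasurableSpace α] {m : Measure α} {h : α → ℝ≥0∞}
    (hh : AEMeasurable h m) :
    ∃ k : α → ℝ≥0∞, Measurable k ∧ (∀ x, h x ≤ k x) ∧ ∫⁻ x, k x ∂m = ∫⁻ x, h x ∂m := by
  classical
  set N := toMeasurable m {x | h x ≠ hh.mk h x} with hN
  have hN0 : m N = 0 := by
    rw [hN, measure_toMeasurable]; exact hh.ae_eq_mk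
  refine ⟨N.piecewise (fun _ => ∞) (hh.mk h), ?_, fun x => ?_, ?_⟩
  · exact Measurable.piecewise (measurableSet_toMeasurable _ _) measurable_const hh.measurable_mk
  · by_cases hx : x ∈ N
    · simp [hx]
    · rw [Set.piecewise_eq_of_notMem _ _ _ hx]
      by_contra hc
      exact hx (subset_toMeasurable _ _ (show h x ≠ hh.mk h x from fun h' => hc h'.le))
  · refine lintegral_congr_ae ?_
    have : ∀ᵐ x ∂m, x ∉ N := measure_eq_zero_iff_ae_notMem.1 hN0
    filter_upwards [this, hh.ae_eq_mk] with x hx hx'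
    rw [Set.piecewise_eq_of_notMem _ _ _ hx, hx']

theorem pl_real {n : ℕ} {θ : ℝ} (h0 : 0 < θ) (h1 : θ < 1) {f g h : En n → ℝ}
    (hf0 : ∀ x, 0 ≤ f x) (hg0 : ∀ x, 0 ≤ g x) (hh0 : ∀ x, 0 ≤ h x)
    (hfi : Integrable f) (hgi : Integrable g) (hhi : Integrable h)
    (hf1 : ∫ x, f x = 1) (hg1 : ∫ x, g x = 1)
    (H : ∀ x y, f x ≠ 0 → g y ≠ 0 → f x ^ θ * g y ^ (1 - θ) ≤ h (θ • x + (1 - θ) • y)) :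
    1 ≤ ∫ x, h x := by
  have h1' : 0 < 1 - θ := by linarith
  obtain ⟨f', mf, lf, ef⟩ := exists_measurable_le_lintegral_eq volume (fun x => ENNReal.ofReal (f x))
  obtain ⟨g', mg, lg, eg⟩ := exists_measurable_le_lintegral_eq volume (fun x => ENNReal.ofReal (g x))
  obtain ⟨h', mh, lh, eh⟩ := exists_meas_majorant (m := volume) (h := fun x => ENNReal.ofReal (h x))
    hhi.aemeasurable.ennreal_ofReal
  have key := pl_euclid n θ h0 h1 f' g' h' mf mg mh (by
    intro x y
    refine le_trans ?_ (lh _)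
    refine le_trans (mul_le_mul' (ENNReal.rpow_le_rpow (lf x) h0.le)
      (ENNReal.rpow_le_rpow (lg y) h1'.le)) ?_
    by_cases hx : f x = 0
    · simp [hx, h0]
    by_cases hy : g y = 0
    · simp [hy, h1]
    have := H x y hx hy
    rw [ENNReal.ofReal_rpow_of_nonneg (hf0 x) h0.le, ENNReal.ofReal_rpow_of_nonneg (hg0 y) h1'.le,
      ← ENNReal.ofReal_mul (Real.rpow_nonneg (hf0 x) _)]
    exact ENNReal.ofReal_le_ofReal this)
  rw [← ef, ← eg, eh, ← ofReal_integral_eq_lintegral_ofReal hfi (Filter.Eventually.of_forall hf0),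
    ← ofReal_integral_eq_lintegral_ofReal hgi (Filter.Eventually.of_forall hg0),
    ← ofReal_integral_eq_lintegral_ofReal hhi (Filter.Eventually.of_forall hh0), hf1, hg1] at key
  simpa using key

theorem integral_rescale {n : ℕ} {s A : ℝ} (hA : 0 < A) (f : En n → ℝ) :
    ∫ x, A ^ (-s) * f (A • x) = A ^ (-((n : ℝ) + s)) * ∫ x, f x := by
  rw [integral_const_mul, Measure.integral_comp_smul_of_nonneg volume f A (hR := hA.le)]
  rw [smul_eq_mul, ← mul_assoc]
  congr 1
  rw [neg_add, Real.rpow_add hA, mul_comm]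
  congr 1
  rw [Real.rpow_neg hA.le, Real.rpow_natCast]
  simp

theorem dgk {n : ℕ} {s a b : ℝ} (hs : 0 < s) (ha : 0 < a) (hb : 0 < b) {f g h : En n → ℝ}
    (hf0 : ∀ x, 0 ≤ f x) (hg0 : ∀ x, 0 ≤ g x) (hh0 : ∀ x, 0 ≤ h x)
    (hfi : Integrable f) (hgi : Integrable g) (hhi : Integrable h)
    (hf1 : 0 < ∫ x, f x) (hg1 : 0 < ∫ x, g x)
    (H : ∀ x y, f x ≠ 0 → g y ≠ 0 →
      a * f x ^ s⁻¹ + b * g y ^ s⁻¹ ≤ h (a • x + b • y) ^ s⁻¹) :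
    a * (∫ x, f x) ^ ((n : ℝ) + s)⁻¹ + b * (∫ x, g x) ^ ((n : ℝ) + s)⁻¹
      ≤ (∫ x, h x) ^ ((n : ℝ) + s)⁻¹ := by
  have hns : 0 < (n : ℝ) + s := by positivity
  set A := (∫ x, f x) ^ ((n : ℝ) + s)⁻¹ with hA
  set B := (∫ x, g x) ^ ((n : ℝ) + s)⁻¹ with hB
  have hA0 : 0 < A := Real.rpow_pos_of_pos hf1 _
  have hB0 : 0 < B := Real.rpow_pos_of_pos hg1 _
  set C := a * A + b * B with hC
  have hC0 : 0 < C := by positivity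
  have eA : A ^ ((n : ℝ) + s) = ∫ x, f x := by
    rw [hA, ← Real.rpow_mul hf1.le, inv_mul_cancel₀ hns.ne', Real.rpow_one]
  have eB : B ^ ((n : ℝ) + s) = ∫ x, g x := by
    rw [hB, ← Real.rpow_mul hg1.le, inv_mul_cancel₀ hns.ne', Real.rpow_one]
  have inte : ∀ (f : En n → ℝ) (A : ℝ), 0 < A → Integrable f →
      Integrable (fun x => A ^ (-s) * f (A • x)) := by
    intro f A hA hf
    exact (hf.comp_smul hA.ne').const_mul _
  have hθ : 1 - a * A / C = b * B / C := by
    rw [eq_div_iff hC0.ne', sub_mul, div_mul_cancel₀ _ hC0.ne', hC]; ring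
  have hθ0 : 0 < a * A / C := by positivity
  have hθ1 : 0 < b * B / C := by positivity
  have root : ∀ (A u : ℝ), 0 < A → 0 ≤ u → (A ^ (-s) * u) ^ s⁻¹ = A⁻¹ * u ^ s⁻¹ := by
    intro A u hA hu
    rw [Real.mul_rpow (by positivity) hu, ← Real.rpow_mul hA.le, neg_mul,
      mul_inv_cancel₀ hs.ne', Real.rpow_neg_one]
  have key := pl_real (θ := a * A / C) hθ0 (by linarith)
    (f := fun x => A ^ (-s) * f (A • x)) (g := fun x => B ^ (-s) * g (B • x))
    (h := fun x => C ^ (-s) * h (C • x))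
    (fun x => mul_nonneg (by positivity) (hf0 _)) (fun x => mul_nonneg (by positivity) (hg0 _))
    (fun x => mul_nonneg (by positivity) (hh0 _)) (inte f A hA0 hfi) (inte g B hB0 hgi)
    (inte h C hC0 hhi)
    (by rw [integral_rescale hA0, ← eA, ← Real.rpow_add hA0]; simp)
    (by rw [integral_rescale hB0, ← eB, ← Real.rpow_add hB0]; simp)
    (by
      intro x y hx hy
      rw [hθ]
      set u := A ^ (-s) * f (A • x) with hu
      set v := B ^ (-s) * g (B • y) with hv
      have hu0 : 0 ≤ u := mul_nonneg (by positivity) (hf0 _)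
      have hv0 : 0 ≤ v := mul_nonneg (by positivity) (hg0 _)
      have h1 := H (A • x) (B • y) (right_ne_zero_of_mul hx) (right_ne_zero_of_mul hy)
      have e : C • ((a * A / C) • x + (b * B / C) • y) = a • A • x + b • B • y := by
        simp only [smul_add, smul_smul]
        rw [mul_div_cancel₀ _ hC0.ne', mul_div_cancel₀ _ hC0.ne']
      rw [e]
      rw [← Real.rpow_le_rpow_iff (z := s⁻¹) (by positivity)
        (mul_nonneg (by positivity) (hh0 _)) (by positivity), root C _ hC0 (hh0 _),
        Real.mul_rpow (by positivity) (by positivity), ← Real.rpow_mul hu0, ← Real.rpow_mul hv0,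
        mul_comm _ s⁻¹, mul_comm _ s⁻¹, Real.rpow_mul hu0, Real.rpow_mul hv0]
      refine (Real.geom_mean_le_arith_mean2_weighted hθ0.le hθ1.le (by positivity)
        (by positivity) (by linarith)).trans ?_
      rw [hu, hv, root A _ hA0 (hf0 _), root B _ hB0 (hg0 _)]
      refine le_trans (le_of_eq ?_) (mul_le_mul_of_nonneg_left h1 (inv_nonneg.2 hC0.le))
      field_simp)
  rw [integral_rescale hC0, Real.rpow_neg hC0.le, ← div_eq_inv_mul, one_le_div (by positivity)] at key
  rw [Real.le_rpow_inv_iff_of_pos hC0.le (integral_nonneg hh0) hns]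
  exact key

theorem one_side {n : ℕ} {s b : ℝ} (hs : 0 < s) (hb : 0 < b) {g h : En n → ℝ} (v : En n)
    (hg0 : ∀ x, 0 ≤ g x) (hh0 : ∀ x, 0 ≤ h x) (hhi : Integrable h)
    (H : ∀ y, g y ≠ 0 → b * g y ^ s⁻¹ ≤ h (v + b • y) ^ s⁻¹) :
    b * (∫ x, g x) ^ ((n : ℝ) + s)⁻¹ ≤ (∫ x, h x) ^ ((n : ℝ) + s)⁻¹ := by
  have hns : 0 < (n : ℝ) + s := by positivity
  have i1 : Integrable (fun x => b ^ (-s) * h (v + b • x)) :=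
    ((hhi.comp_add_left v).comp_smul hb.ne').const_mul _
  have key : ∫ x, g x ≤ ∫ x, b ^ (-s) * h (v + b • x) := by
    refine integral_mono_of_nonneg (Filter.Eventually.of_forall hg0) i1
      (Filter.Eventually.of_forall fun y => ?_)
    by_cases hy : g y = 0
    · simp only [hy]; exact mul_nonneg (by positivity) (hh0 _)
    have h1 := H y hy
    have h2 := Real.rpow_le_rpow (mul_nonneg hb.le (Real.rpow_nonneg (hg0 y) _)) h1 hs.le
    rw [Real.mul_rpow hb.le (Real.rpow_nonneg (hg0 y) _), Real.rpow_inv_rpow (hg0 y) hs.ne',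
      Real.rpow_inv_rpow (hh0 _) hs.ne'] at h2
    simp only
    rw [Real.rpow_neg hb.le, ← div_eq_inv_mul, le_div_iff₀ (by positivity)]
    linarith
  rw [integral_rescale (f := fun x => h (v + x)) hb, integral_add_left_eq_self h v,
    Real.rpow_neg hb.le, ← div_eq_inv_mul, le_div_iff₀ (by positivity)] at key
  rw [Real.le_rpow_inv_iff_of_pos (mul_nonneg hb.le (Real.rpow_nonneg (integral_nonneg hg0) _))
    (integral_nonneg hh0) hns, Real.mul_rpow hb.le (Real.rpow_nonneg (integral_nonneg hg0) _),
    Real.rpow_inv_rpow (integral_nonneg hg0) hns.ne']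
  linarith

theorem pow_out {p ω X Z r : ℝ} (hp : 1 ≤ p) (hω : 0 < ω) (hX : 0 ≤ X)
    (h : ω ^ p⁻¹ * X ^ r⁻¹ ≤ Z ^ r⁻¹) (hZ : 0 ≤ Z) : ω * X ^ (p / r) ≤ Z ^ (p / r) := by
  have hp0 : 0 < p := by linarith
  have := Real.rpow_le_rpow (by positivity) h hp0.le
  rw [Real.mul_rpow (by positivity) (by positivity), Real.rpow_inv_rpow hω.le hp0.ne',
    ← Real.rpow_mul hX, ← Real.rpow_mul hZ] at this
  rwa [div_eq_inv_mul]

theorem lp_prekopa_leindler {n : ℕ} (p s μ ω : ℝ) (hp : 1 ≤ p) (hs : 0 < s)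
    (hμ : 0 < μ) (hω : 0 < ω)
    (f g h : En n → ℝ)
    (hf0 : ∀ x, 0 ≤ f x) (hg0 : ∀ x, 0 ≤ g x) (hh0 : ∀ x, 0 ≤ h x)
    (hfi : Integrable f) (hgi : Integrable g) (hhi : Integrable h)
    (hfs : (fsupp f).Nonempty) (hgs : (fsupp g).Nonempty)
    (hcond : ∀ x ∈ fsupp f, ∀ y ∈ fsupp g, ∀ t ∈ Icc (0:ℝ) 1,
      ((1 - t) ^ (1 - p⁻¹) * μ ^ p⁻¹) * f x ^ s⁻¹ + (t ^ (1 - p⁻¹) * ω ^ p⁻¹) * g y ^ s⁻¹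
        ≤ h (((1 - t) ^ (1 - p⁻¹) * μ ^ p⁻¹) • x + (t ^ (1 - p⁻¹) * ω ^ p⁻¹) • y) ^ s⁻¹) :
    μ * (∫ x, f x) ^ (p / ((n : ℝ) + s)) + ω * (∫ x, g x) ^ (p / ((n : ℝ) + s))
      ≤ (∫ x, h x) ^ (p / ((n : ℝ) + s)) := by
  have hp0 : 0 < p := by linarith
  have hns : 0 < (n : ℝ) + s := by positivity
  have hF : 0 ≤ ∫ x, f x := integral_nonneg hf0
  have hG : 0 ≤ ∫ x, g x := integral_nonneg hg0
  have hH : 0 ≤ ∫ x, h x := integral_nonneg hh0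
  have sub : ∀ (f : En n → ℝ) x, f x ≠ 0 → x ∈ fsupp f := fun f x hx => subset_closure hx
  have hpr : p / ((n : ℝ) + s) ≠ 0 := by positivity
  rcases hF.eq_or_lt with hF0 | hF0
  · obtain ⟨x, hx⟩ := hfs
    rw [← hF0, Real.zero_rpow hpr, mul_zero, zero_add]
    refine pow_out hp hω hG ?_ hH
    refine one_side hs (by positivity) (((1 - 1 : ℝ) ^ (1 - p⁻¹) * μ ^ p⁻¹) • x) hg0 hh0 hhi ?_
    intro y hy
    have := hcond x hx y (sub g y hy) 1 (by simp)
    rw [Real.one_rpow, one_mul] at this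
    refine le_trans ?_ this
    have h1 := Real.rpow_nonneg (hf0 x) s⁻¹
    have h2 : (0:ℝ) ≤ (1 - 1 : ℝ) ^ (1 - p⁻¹) := Real.rpow_nonneg (by simp) _
    have : 0 ≤ (1 - 1 : ℝ) ^ (1 - p⁻¹) * μ ^ p⁻¹ * f x ^ s⁻¹ := by positivity
    linarith
  rcases hG.eq_or_lt with hG0 | hG0
  · obtain ⟨y, hy⟩ := hgs
    rw [← hG0, Real.zero_rpow hpr, mul_zero, add_zero]
    refine pow_out hp hμ hF ?_ hH
    refine one_side hs (by positivity) (((0 : ℝ) ^ (1 - p⁻¹) * ω ^ p⁻¹) • y) hf0 hh0 hhi ?_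
    intro x hx
    have := hcond x (sub f x hx) y hy 0 (by simp)
    rw [sub_zero, Real.one_rpow, one_mul, add_comm (_ • x)] at this
    refine le_trans ?_ this
    have h1 := Real.rpow_nonneg (hg0 y) s⁻¹
    have h2 : (0:ℝ) ≤ (0 : ℝ) ^ (1 - p⁻¹) := Real.rpow_nonneg (by simp) _
    have : 0 ≤ (0 : ℝ) ^ (1 - p⁻¹) * ω ^ p⁻¹ * g y ^ s⁻¹ := by positivity
    linarith
  have eX : ∀ X : ℝ, 0 ≤ X → X ^ (p / ((n : ℝ) + s)) = (X ^ ((n : ℝ) + s)⁻¹) ^ p := by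
    intro X hX
    rw [← Real.rpow_mul hX, div_eq_inv_mul]
  set A := (∫ x, f x) ^ ((n : ℝ) + s)⁻¹ with hA
  set B := (∫ x, g x) ^ ((n : ℝ) + s)⁻¹ with hB
  have hA0 : 0 < A := Real.rpow_pos_of_pos hF0 _
  have hB0 : 0 < B := Real.rpow_pos_of_pos hG0 _
  rw [eX _ hF, eX _ hG, eX _ hH, ← hA, ← hB]
  set u := μ * A ^ p with hu
  set v := ω * B ^ p with hv
  have hu0 : 0 < u := by positivity
  have hv0 : 0 < v := by positivity
  have huv : 0 < u + v := by positivity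
  have ht : 1 - v / (u + v) = u / (u + v) := by
    rw [eq_div_iff huv.ne', sub_mul, div_mul_cancel₀ _ huv.ne']; ring
  have htp : 0 < u / (u + v) := by positivity
  have htp' : 0 < v / (u + v) := by positivity
  have key := dgk hs (a := (u / (u + v)) ^ (1 - p⁻¹) * μ ^ p⁻¹)
    (b := (v / (u + v)) ^ (1 - p⁻¹) * ω ^ p⁻¹) (by positivity) (by positivity)
    hf0 hg0 hh0 hfi hgi hhi hF0 hG0 (by
      intro x y hx hy
      have := hcond x (sub f x hx) y (sub g y hy) (v / (u + v)) ⟨htp'.le, by linarith⟩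
      rwa [ht] at this)
  rw [← hA, ← hB] at key
  have term : ∀ μ A u w : ℝ, 0 < μ → 0 < A → 0 < w → u = μ * A ^ p →
      (u / w) ^ (1 - p⁻¹) * μ ^ p⁻¹ * A = u * w ^ (p⁻¹ - 1) := by
    intro μ A u w hμ hA hw hu
    have hu0 : 0 < u := by rw [hu]; positivity
    have e1 : μ ^ p⁻¹ * A = u ^ p⁻¹ := by
      rw [hu, Real.mul_rpow hμ.le (by positivity), Real.rpow_rpow_inv hA.le hp0.ne']
    rw [mul_assoc, e1, Real.div_rpow hu0.le hw.le, div_eq_mul_inv, ← Real.rpow_neg hw.le,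
      mul_right_comm, ← Real.rpow_add hu0]
    simp
  rw [term μ A u _ hμ hA0 huv hu, term ω B v _ hω hB0 huv hv, ← add_mul] at key
  have e : (u + v) * (u + v) ^ (p⁻¹ - 1) = (u + v) ^ p⁻¹ := by
    rw [Real.rpow_sub_one huv.ne']; field_simp
  rw [e, Real.rpow_inv_le_iff_of_pos huv.le (by positivity) hp0] at key
  exact key

end
end

section
/- Let p ≥ 1. If K and L are nonempty compact sets in ℝⁿ, then Vₙ(K +ₚ L)^{p/n} ≥ Vₙ(K)^{p/n} + Vₙ(L)^{p/n}, where K +ₚ L = {(1-λ)^{1/q} x + λ^{1/q} y : x ∈ K, y ∈ L, 0 ≤ λ ≤ 1} and q is the Hölder conjugate of p (with 1/q = 0 when p = 1), and Vₙ denotes n-dimensional Lebesgue measure (outer measure if K +ₚ L is not measurable). -/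
open MeasureTheory Set Function

noncomputable section

/-- the pointwise `L_p` sum of sets (Lutwak–Yang–Zhang), with `1/q = 1 - 1/p`. -/
def lpSum {n : ℕ} (p : ℝ) (K L : Set (En n)) : Set (En n) :=
  {z | ∃ x ∈ K, ∃ y ∈ L, ∃ t ∈ Icc (0:ℝ) 1,
    z = ((1 - t) ^ (1 - p⁻¹)) • x + (t ^ (1 - p⁻¹)) • y}

open scoped Pointwise

lemma bm1_compact {A B : Set ℝ} (hA : IsCompact A) (hB : IsCompact B) (hAn : A.Nonempty)
    (hBn : B.Nonempty) : volume A + volume B ≤ volume (A + B) := by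
  obtain ⟨a, ha, hamax⟩ := hA.exists_isGreatest hAn
  obtain ⟨b, hb, hbmin⟩ := hB.exists_isLeast hBn
  have h1 : volume ((fun x => b + x) '' A) = volume A := by
    rw [image_add_left, measure_preimage_add]
  have h2 : volume ((fun x => a + x) '' B) = volume B := by
    rw [image_add_left, measure_preimage_add]
  have hm : MeasurableSet ((fun x => a + x) '' B) :=
    (hB.image (by fun_prop)).measurableSet
  have hd : AEDisjoint volume ((fun x => b + x) '' A) ((fun x => a + x) '' B) := by
    refine measure_mono_null (t := {a + b}) ?_ (by simp)
    rintro _ ⟨⟨x, hx, rfl⟩, ⟨y, hy, hxy⟩⟩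
    have := hamax hx
    have := hbmin hy
    simp only [mem_singleton_iff] at *
    linarith
  rw [← h1, ← h2, ← measure_union₀ hm.nullMeasurableSet hd]
  apply measure_mono
  rintro _ (⟨x, hx, rfl⟩ | ⟨y, hy, rfl⟩)
  · exact ⟨x, hx, b, hb, add_comm _ _⟩
  · exact ⟨a, ha, y, hy, rfl⟩

lemma bm1 {A B : Set ℝ} (hA : MeasurableSet A) (hB : MeasurableSet B) (hAn : A.Nonempty)
    (hBn : B.Nonempty) : volume A + volume B ≤ volume (A + B) := by
  obtain ⟨a, ha⟩ := hAn
  obtain ⟨b, hb⟩ := hBn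
  have key : ∀ K ⊆ A, IsCompact K → ∀ L ⊆ B, IsCompact L →
      volume K + volume L ≤ volume (A + B) := by
    intro K hKA hK L hLB hL
    calc volume K + volume L ≤ volume (insert a K) + volume (insert b L) := by
          gcongr <;> exact subset_insert _ _
      _ ≤ volume (insert a K + insert b L) :=
          bm1_compact (hK.insert a) (hL.insert b) (insert_nonempty _ _) (insert_nonempty _ _)
      _ ≤ _ := by
          apply measure_mono
          exact add_subset_add (insert_subset ha hKA) (insert_subset hb hLB)
  rw [hA.measure_eq_iSup_isCompact, hB.measure_eq_iSup_isCompact]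
  simp only [iSup_and']
  refine ENNReal.biSup_add_biSup_le' (p := fun K => K ⊆ A ∧ IsCompact K)
    (q := fun L => L ⊆ B ∧ IsCompact L) ⟨∅, by simp⟩ ⟨∅, by simp⟩ ?_
  intro K hK L hL
  exact key K hK.1 hK.2 L hL.1 hL.2

lemma bm1' {A B C : Set ℝ} (hA : MeasurableSet A) (hB : MeasurableSet B) (hAn : A.Nonempty)
    (hBn : B.Nonempty) {t : ℝ} (h0 : 0 < t) (h1 : t < 1)
    (hC : ∀ x ∈ A, ∀ y ∈ B, (1 - t) * x + t * y ∈ C) :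
    ENNReal.ofReal (1 - t) * volume A + ENNReal.ofReal t * volume B ≤ volume C := by
  have e1 : volume ((1 - t) • A) = ENNReal.ofReal (1 - t) * volume A := by
    rw [Measure.addHaar_smul]; simp [abs_of_pos (sub_pos.2 h1)]
  have e2 : volume (t • B) = ENNReal.ofReal t * volume B := by
    rw [Measure.addHaar_smul]; simp [abs_of_pos h0]
  rw [← e1, ← e2]
  refine (bm1 (hA.const_smul₀ _) (hB.const_smul₀ _) hAn.smul_set hBn.smul_set).trans ?_
  apply measure_mono
  rintro _ ⟨_, ⟨x, hx, rfl⟩, _, ⟨y, hy, rfl⟩, rfl⟩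
  exact hC x hx y hy

lemma layer {f : ℝ → ENNReal} (hf : Measurable f) (h1 : ∀ x, f x ≤ 1) :
    ∫⁻ x, f x = ∫⁻ s in Ioo (0:ℝ) 1, volume {x | ENNReal.ofReal s < f x} := by
  have hfin : ∀ x, f x ≠ ⊤ := fun x => ((h1 x).trans_lt ENNReal.one_lt_top).ne
  have e : ∀ x, f x = ENNReal.ofReal (f x).toReal := fun x => (ENNReal.ofReal_toReal (hfin x)).symm
  have := lintegral_eq_lintegral_meas_lt (volume : Measure ℝ) (f := fun x => (f x).toReal)
    (Filter.Eventually.of_forall fun x => ENNReal.toReal_nonneg) hf.ennreal_toReal.aemeasurable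
  simp_rw [← e] at this
  rw [this, ← Ioo_union_Ici_eq_Ioi (zero_lt_one' ℝ), lintegral_union measurableSet_Ici]
  · have z : ∫⁻ s in Ici (1:ℝ), volume {a | s < (f a).toReal} = 0 := by
      rw [setLIntegral_congr_fun (g := fun _ => 0) measurableSet_Ici]
      · simp
      · intro s hs
        have : {a | s < (f a).toReal} = ∅ := by
          ext a
          simp only [mem_ofPred_eq, mem_empty_iff_false, iff_false, not_lt]
          exact (ENNReal.toReal_le_of_le_ofReal (by simp) (by simpa using h1 a)).trans hs
        simp [this]
    rw [z, add_zero]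
    refine setLIntegral_congr_fun measurableSet_Ioo fun s hs => ?_
    congr 1
    ext a
    exact (ENNReal.ofReal_lt_iff_lt_toReal hs.1.le (hfin a)).symm
  · rw [Set.disjoint_left]; intro x hx hx'; exact absurd hx.2 (not_lt.2 hx')

lemma layer_le {f : ℝ → ENNReal} (hf : Measurable f) :
     ∫⁻ s in Ioo (0:ℝ) 1, volume {x | ENNReal.ofReal s < f x} ≤ ∫⁻ x, f x := by
  have := layer (f := fun x => min (f x) 1) (hf.min measurable_const) (fun x => min_le_right _ _)
  calc _ = ∫⁻ x, min (f x) 1 := by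
        rw [this]
        refine setLIntegral_congr_fun measurableSet_Ioo fun s hs => ?_
        congr 1
        ext a
        simp [hs.2]
    _ ≤ _ := lintegral_mono fun x => min_le_left _ _

lemma pl_norm {f g h : ℝ → ENNReal} (hf : Measurable f) (hg : Measurable g) (hh : Measurable h)
    {t : ℝ} (h0 : 0 < t) (h1 : t < 1) (sf : ⨆ x, f x = 1) (sg : ⨆ x, g x = 1)
    (H : ∀ x y, f x ^ (1 - t) * g y ^ t ≤ h ((1 - t) * x + t * y)) :
    ENNReal.ofReal (1 - t) * (∫⁻ x, f x) + ENNReal.ofReal t * (∫⁻ x, g x) ≤ ∫⁻ x, h x := by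
  refine le_trans ?_ (layer_le hh)
  rw [layer hf (fun x => sf ▸ le_iSup f x), layer hg (fun x => sg ▸ le_iSup g x),
    ← lintegral_const_mul' _ _ ENNReal.ofReal_ne_top,
    ← lintegral_const_mul' _ _ ENNReal.ofReal_ne_top]
  refine (le_lintegral_add _ _).trans ?_
  refine setLIntegral_mono' measurableSet_Ioo fun s hs => ?_
  have hs1 : ENNReal.ofReal s < 1 := by simpa using hs.2
  apply bm1' (hf measurableSet_Ioi) (hg measurableSet_Ioi) _ _ h0 h1
  · intro x hx y hy
    have hx' : ENNReal.ofReal s < f x := hx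
    have hy' : ENNReal.ofReal s < g y := hy
    refine lt_of_lt_of_le ?_ (H x y)
    calc ENNReal.ofReal s = ENNReal.ofReal s ^ (1 - t) * ENNReal.ofReal s ^ t := by
          rw [← ENNReal.rpow_add _ _ (by simpa using hs.1) (by simp)]; simp
      _ < _ := ENNReal.mul_lt_mul (ENNReal.rpow_lt_rpow hx' (by linarith))
          (ENNReal.rpow_lt_rpow hy' h0)
  · exact lt_iSup_iff.1 (sf ▸ hs1)
  · exact lt_iSup_iff.1 (sg ▸ hs1)

lemma amgm {t : ℝ} (h0 : 0 < t) (h1 : t < 1) (a b : ENNReal) :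
    a ^ (1 - t) * b ^ t ≤ ENNReal.ofReal (1 - t) * a + ENNReal.ofReal t * b := by
  have h1' : 0 < 1 - t := by linarith
  induction a with
  | top => rw [ENNReal.mul_top (by simpa using h1)]; simp
  | coe a =>
    induction b with
    | top => rw [ENNReal.mul_top (by simpa using h0)]; simp
    | coe b =>
      have := NNReal.geom_mean_le_arith_mean2_weighted (1-t).toNNReal t.toNNReal a b (by
        rw [← Real.toNNReal_add h1'.le h0.le]; simp)
      rw [Real.coe_toNNReal _ h1'.le, Real.coe_toNNReal _ h0.le] at this
      rw [← ENNReal.coe_rpow_of_nonneg _ h1'.le, ← ENNReal.coe_rpow_of_nonneg _ h0.le]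
      rw [ENNReal.ofReal, ENNReal.ofReal]
      exact_mod_cast this

lemma pl_bdd {f g h : ℝ → ENNReal} (hf : Measurable f) (hg : Measurable g) (hh : Measurable h)
    {t : ℝ} (h0 : 0 < t) (h1 : t < 1) (sf : ⨆ x, f x ≠ ⊤) (sg : ⨆ x, g x ≠ ⊤)
    (H : ∀ x y, f x ^ (1 - t) * g y ^ t ≤ h ((1 - t) * x + t * y)) :
    (∫⁻ x, f x) ^ (1 - t) * (∫⁻ x, g x) ^ t ≤ ∫⁻ x, h x := by
  have h1' : 0 < 1 - t := by linarith
  set M := ⨆ x, f x with hM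
  set m := ⨆ x, g x with hm
  by_cases zf : M = 0
  · have : ∀ x, f x = 0 := fun x => le_antisymm (zf ▸ le_iSup f x) (zero_le)
    simp [this, ENNReal.zero_rpow_of_pos h1']
  by_cases zg : m = 0
  · have : ∀ x, g x = 0 := fun x => le_antisymm (zg ▸ le_iSup g x) (zero_le)
    simp [this, ENNReal.zero_rpow_of_pos h0]
  set C := M ^ (1 - t) * m ^ t with hC
  have C0 : C ≠ 0 := by
    simp [hC, zf, zg, sf, sg]
  have Ct : C ≠ ⊤ := by
    apply ENNReal.mul_ne_top <;> apply ENNReal.rpow_ne_top_of_nonneg <;> first | assumption | linarith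
  have key := pl_norm (f := fun x => M⁻¹ * f x) (g := fun x => m⁻¹ * g x) (h := fun x => C⁻¹ * h x)
    (hf.const_mul _) (hg.const_mul _) (hh.const_mul _) h0 h1
    (by rw [← ENNReal.mul_iSup, ← hM, ENNReal.inv_mul_cancel zf sf])
    (by rw [← ENNReal.mul_iSup, ← hm, ENNReal.inv_mul_cancel zg sg])
    (by
      intro x y
      rw [ENNReal.mul_rpow_of_nonneg _ _ h1'.le, ENNReal.mul_rpow_of_nonneg _ _ h0.le, mul_mul_mul_comm,
        ENNReal.inv_rpow, ENNReal.inv_rpow, ← ENNReal.mul_inv]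
      · gcongr
        exact H x y
      · left; simp [zf, sf]
      · left; exact ENNReal.rpow_ne_top_of_nonneg h1'.le sf)
  rw [lintegral_const_mul _ hf, lintegral_const_mul _ hg, lintegral_const_mul _ hh] at key
  have k2 := (amgm h0 h1 _ _).trans key
  have e1 : ∫⁻ x, f x = M * (M⁻¹ * ∫⁻ x, f x) := by
    rw [← mul_assoc, ENNReal.mul_inv_cancel zf sf, one_mul]
  have e2 : ∫⁻ x, g x = m * (m⁻¹ * ∫⁻ x, g x) := by
    rw [← mul_assoc, ENNReal.mul_inv_cancel zg sg, one_mul]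
  have e3 : ∫⁻ x, h x = C * (C⁻¹ * ∫⁻ x, h x) := by
    rw [← mul_assoc, ENNReal.mul_inv_cancel C0 Ct, one_mul]
  rw [e1, e2, e3, ENNReal.mul_rpow_of_nonneg _ _ h1'.le, ENNReal.mul_rpow_of_nonneg _ _ h0.le,
    mul_mul_mul_comm]
  gcongr

lemma trunc_tendsto {f : ℝ → ENNReal} (hf : Measurable f) :
    Filter.Tendsto (fun N : ℕ => ∫⁻ x, min (f x) N) Filter.atTop (nhds (∫⁻ x, f x)) := by
  refine lintegral_tendsto_of_tendsto_of_monotone (fun n => (hf.min measurable_const).aemeasurable)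
    ?_ ?_
  · refine Filter.Eventually.of_forall fun x a b hab => ?_
    exact min_le_min_left _ (by exact_mod_cast hab)
  · refine Filter.Eventually.of_forall fun x => ?_
    have : Filter.Tendsto (fun n : ℕ => min (f x) (n : ENNReal)) Filter.atTop (nhds (min (f x) ⊤)) :=
      tendsto_const_nhds.min ENNReal.tendsto_nat_nhds_top
    simpa using this

lemma pl_one_s1 {f g h : ℝ → ENNReal} (hf : Measurable f) (hg : Measurable g) (hh : Measurable h)
    {t : ℝ} (h0 : 0 < t) (h1 : t < 1)
    (H : ∀ x y, f x ^ (1 - t) * g y ^ t ≤ h ((1 - t) * x + t * y)) :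
    (∫⁻ x, f x) ^ (1 - t) * (∫⁻ x, g x) ^ t ≤ ∫⁻ x, h x := by
  have h1' : 0 < 1 - t := by linarith
  by_cases zf : ∫⁻ x, f x = 0
  · simp [zf, ENNReal.zero_rpow_of_pos h1']
  by_cases zg : ∫⁻ x, g x = 0
  · simp [zg, ENNReal.zero_rpow_of_pos h0]
  have T : Filter.Tendsto (fun N : ℕ => (∫⁻ x, min (f x) N) ^ (1 - t) * (∫⁻ x, min (g x) N) ^ t)
      Filter.atTop (nhds ((∫⁻ x, f x) ^ (1 - t) * (∫⁻ x, g x) ^ t)) := by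
    apply ENNReal.Tendsto.mul
    · exact (ENNReal.continuous_rpow_const.tendsto _).comp (trunc_tendsto hf)
    · left; simp [zf, h1'.not_gt]
    · exact (ENNReal.continuous_rpow_const.tendsto _).comp (trunc_tendsto hg)
    · left; simp [zg, h0.not_gt]
  refine le_of_tendsto' T fun N => ?_
  have bd : ∀ u : ℝ → ENNReal, ⨆ x, min (u x) (N : ENNReal) ≠ ⊤ := fun u =>
    ((iSup_le fun x => min_le_right _ _).trans_lt (ENNReal.natCast_lt_top N)).ne
  refine pl_bdd (hf.min measurable_const) (hg.min measurable_const) hh h0 h1 (bd f) (bd g) ?_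
  intro x y
  refine le_trans ?_ (H x y)
  gcongr <;> exact min_le_left _ _

lemma pl {t : ℝ} (h0 : 0 < t) (h1 : t < 1) (n : ℕ) : ∀ {f g h : (Fin n → ℝ) → ENNReal}
    (_ : Measurable f) (_ : Measurable g) (_ : Measurable h)
    (_ : ∀ x y, f x ^ (1 - t) * g y ^ t ≤ h ((1 - t) • x + t • y)),
    (∫⁻ x, f x) ^ (1 - t) * (∫⁻ x, g x) ^ t ≤ ∫⁻ x, h x := by
  induction n with
  | zero =>
    intro f g h _ _ _ H
    have : (volume : Measure (Fin 0 → ℝ)) univ = 1 := by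
      simp [volume_pi]
    simp only [lintegral_unique, this, mul_one]
    convert H default default
  | succ n ih =>
    intro f g h hf hg hh H
    let e := MeasurableEquiv.piFinSuccAbove (fun _ : Fin (n+1) => ℝ) 0
    have he : MeasurePreserving e.symm :=
      (volume_preserving_piFinSuccAbove (fun _ : Fin (n+1) => ℝ) 0).symm
    have I : ∀ {u : (Fin (n+1) → ℝ) → ENNReal}, Measurable u →
        ∫⁻ x, u x = ∫⁻ r, ∫⁻ z, u (e.symm (r, z)) := by
      intro u hu
      rw [← he.lintegral_comp hu, Measure.volume_eq_prod]
      exact lintegral_prod _ (hu.comp e.symm.measurable).aemeasurable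
    have lin : ∀ r s z w, e.symm ((1 - t) * r + t * s, (1 - t) • z + t • w) =
        (1 - t) • e.symm (r, z) + t • e.symm (s, w) := by
      intro r s z w
      ext i
      refine Fin.cases ?_ (fun j => ?_) i <;> simp [e, MeasurableEquiv.piFinSuccAbove]
    have ms : ∀ {u : (Fin (n+1) → ℝ) → ENNReal}, Measurable u →
      Measurable (fun q : ℝ × (Fin n → ℝ) => u (e.symm q)) := fun hu => hu.comp e.symm.measurable
    rw [I hf, I hg, I hh]
    apply pl_one_s1 (ms hf).lintegral_prod_right' (ms hg).lintegral_prod_right'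
      (ms hh).lintegral_prod_right' h0 h1
    intro r s
    apply ih
    · exact (ms hf).comp measurable_prodMk_left
    · exact (ms hg).comp measurable_prodMk_left
    · exact (ms hh).comp measurable_prodMk_left
    · intro z w
      rw [lin]
      exact H _ _

lemma bm_mult {n : ℕ} {K L : Set (En n)} (hK : IsCompact K) (hL : IsCompact L) {t : ℝ}
    (h0 : 0 < t) (h1 : t < 1) :
    volume K ^ (1 - t) * volume L ^ t ≤ volume ((1 - t) • K + t • L) := by
  have h1' : 0 < 1 - t := by linarith
  have hM : MeasurableSet ((1 - t) • K + t • L) := ((hK.smul _).add (hL.smul _)).measurableSet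
  have mp := PiLp.volume_preserving_toLp (Fin n)
  have key : ∀ {S : Set (En n)}, MeasurableSet S →
      MeasurableSet (@WithLp.toLp 2 (Fin n → ℝ) ⁻¹' S) ∧
      ∫⁻ x, (@WithLp.toLp 2 (Fin n → ℝ) ⁻¹' S).indicator (1 : (Fin n → ℝ) → ENNReal) x = volume S := by
    intro S hS
    have := mp.measurable hS
    refine ⟨this, ?_⟩
    rw [lintegral_indicator_one this, mp.measure_preimage hS.nullMeasurableSet]
  rw [← (key hK.measurableSet).2, ← (key hL.measurableSet).2, ← (key hM).2]
  refine pl h0 h1 n (measurable_one.indicator (key hK.measurableSet).1)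
    (measurable_one.indicator (key hL.measurableSet).1) (measurable_one.indicator (key hM).1) ?_
  intro x y
  by_cases hx : WithLp.toLp 2 x ∈ K
  · by_cases hy : WithLp.toLp 2 y ∈ L
    · have hz : WithLp.toLp 2 ((1 - t) • x + t • y) ∈ (1 - t) • K + t • L :=
        ⟨_, ⟨_, hx, rfl⟩, _, ⟨_, hy, rfl⟩, rfl⟩
      simp [indicator, hx, hy, mem_preimage, hz, -WithLp.toLp_add, -WithLp.toLp_smul]
    · simp [indicator, hy, ENNReal.zero_rpow_of_pos h0]
  · simp [indicator, hx, ENNReal.zero_rpow_of_pos h1']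

lemma vol_right_le {n : ℕ} (p : ℝ) {K L : Set (En n)} (hK : K.Nonempty) :
    volume L ≤ volume (lpSum p K L) := by
  obtain ⟨x, hx⟩ := hK
  rw [← measure_preimage_add volume (-(((1 - 1 : ℝ) ^ (1 - p⁻¹)) • x)) L, ← image_add_left]
  apply measure_mono
  rintro _ ⟨y, hy, rfl⟩
  exact ⟨x, hx, y, hy, 1, by simp, by simp⟩

lemma vol_left_le {n : ℕ} (p : ℝ) {K L : Set (En n)} (hL : L.Nonempty) :
    volume K ≤ volume (lpSum p K L) := by
  obtain ⟨y, hy⟩ := hL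
  rw [← measure_preimage_add volume (-(((0 : ℝ) ^ (1 - p⁻¹)) • y)) K, ← image_add_left]
  apply measure_mono
  rintro _ ⟨x, hx, rfl⟩
  exact ⟨x, hx, y, hy, 0, by simp, by simp [add_comm]⟩

/-- normalising a set of finite positive volume -/
lemma vol_normalize {n : ℕ} (hn : 0 < n) {K : Set (En n)} (h0 : volume K ≠ 0)
    (ht : volume K ≠ ⊤) : volume ((((volume K).toReal ^ (1 / (n:ℝ)))⁻¹) • K) = 1 := by
  have hpos : 0 < (volume K).toReal := ENNReal.toReal_pos h0 ht
  rw [Measure.addHaar_smul]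
  simp only [finrank_euclideanSpace, Fintype.card_fin]
  rw [inv_pow, ← Real.rpow_natCast, ← Real.rpow_mul hpos.le, one_div,
    inv_mul_cancel₀ (by positivity), Real.rpow_one, abs_of_pos (by positivity),
    ENNReal.ofReal_inv_of_pos hpos, ENNReal.ofReal_toReal ht, ENNReal.inv_mul_cancel h0 ht]

lemma coef {A c p n : ℝ} (hA : 0 < A) (hc : 0 < c) (hp : 0 < p) :
    (A ^ (p / n) / c) ^ (1 - p⁻¹) = c ^ p⁻¹ * (A ^ (p / n) / c * (A ^ (1 / n))⁻¹) := by
  rw [Real.rpow_sub (by positivity), Real.rpow_one, Real.div_rpow (by positivity) hc.le,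
    ← Real.rpow_mul hA.le]
  have : p / n * p⁻¹ = 1 / n := by field_simp
  rw [this]
  field_simp

/-- **The `L_p` Brunn–Minkowski inequality for compact sets** (Lutwak–Yang–Zhang).
`volume` applied to an arbitrary set is the outer Lebesgue measure. -/
theorem lp_brunn_minkowski {n : ℕ} (hn : 0 < n) (p : ℝ) (hp : 1 ≤ p)
    (K L : Set (En n)) (hK : K.Nonempty) (hL : L.Nonempty)
    (hKc : IsCompact K) (hLc : IsCompact L) :
    volume K ^ (p / n) + volume L ^ (p / n) ≤ volume (lpSum p K L) ^ (p / n) := by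
  have hp0 : 0 < p := by linarith
  have hn' : (0:ℝ) < n := by exact_mod_cast hn
  have hpn : 0 < p / n := by positivity
  by_cases zK : volume K = 0
  · rw [zK, ENNReal.zero_rpow_of_pos hpn, zero_add]
    exact ENNReal.rpow_le_rpow (vol_right_le p hK) hpn.le
  by_cases zL : volume L = 0
  · rw [zL, ENNReal.zero_rpow_of_pos hpn, add_zero]
    exact ENNReal.rpow_le_rpow (vol_left_le p hL) hpn.le
  have tK : volume K ≠ ⊤ := hKc.measure_lt_top.ne
  have tL : volume L ≠ ⊤ := hLc.measure_lt_top.ne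
  have nK := vol_normalize hn zK tK
  have nL := vol_normalize hn zL tL
  have eK : volume K = ENNReal.ofReal (volume K).toReal := (ENNReal.ofReal_toReal tK).symm
  have eL : volume L = ENNReal.ofReal (volume L).toReal := (ENNReal.ofReal_toReal tL).symm
  have hA : 0 < (volume K).toReal := ENNReal.toReal_pos zK tK
  have hB : 0 < (volume L).toReal := ENNReal.toReal_pos zL tL
  generalize (volume K).toReal = A at *
  generalize (volume L).toReal = B at *
  rw [eK, eL, ENNReal.ofReal_rpow_of_pos hA, ENNReal.ofReal_rpow_of_pos hB,
    ← ENNReal.ofReal_add (by positivity) (by positivity)]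
  have hAp : 0 < A ^ (p / n) := by positivity
  have hBp : 0 < B ^ (p / n) := by positivity
  set c := A ^ (p / n) + B ^ (p / n) with hc
  have hc0 : 0 < c := by positivity
  set t := B ^ (p / n) / c with ht
  have ht0 : 0 < t := by positivity
  have h1t : 1 - t = A ^ (p / n) / c := by
    rw [ht, hc]; field_simp; ring
  have ht1 : t < 1 := by
    have : 0 < 1 - t := by rw [h1t]; positivity
    linarith
  have bm := bm_mult (hKc.smul (A ^ (1 / (n:ℝ)))⁻¹) (hLc.smul (B ^ (1 / (n:ℝ)))⁻¹) ht0 ht1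
  rw [nK, nL, ENNReal.one_rpow, ENNReal.one_rpow, one_mul] at bm
  have sub : c ^ p⁻¹ • ((1 - t) • ((A ^ (1 / (n:ℝ)))⁻¹ • K) + t • ((B ^ (1 / (n:ℝ)))⁻¹ • L)) ⊆
      lpSum p K L := by
    rintro _ ⟨_, ⟨_, ⟨_, ⟨x, hx, rfl⟩, rfl⟩, _, ⟨_, ⟨y, hy, rfl⟩, rfl⟩, rfl⟩, rfl⟩
    refine ⟨x, hx, y, hy, t, ⟨ht0.le, ht1.le⟩, ?_⟩
    rw [h1t, ht, coef hA hc0 hp0, coef hB hc0 hp0]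
    simp only [smul_add, smul_smul, mul_assoc]
  have fin : ENNReal.ofReal ((c ^ p⁻¹) ^ n) ≤ volume (lpSum p K L) := by
    refine le_trans ?_ (measure_mono sub)
    rw [Measure.addHaar_smul]
    simp only [finrank_euclideanSpace, Fintype.card_fin]
    rw [abs_of_pos (by positivity)]
    exact le_mul_of_one_le_right (zero_le) bm
  refine le_trans (le_of_eq ?_) (ENNReal.rpow_le_rpow fin hpn.le)
  rw [ENNReal.ofReal_rpow_of_pos (by positivity), ← Real.rpow_natCast, ← Real.rpow_mul hc0.le,
    ← Real.rpow_mul hc0.le]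
  have : p⁻¹ * n * (p / n) = 1 := by field_simp
  rw [this, Real.rpow_one]

end
end
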